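/- Let G be a P4-free simple graph with at least two vertices. Then the following three properties are equivalent: (1) the prism G □ K2 has a Hamiltonian cycle; (2) G has a spanning 2-walk; (3) G is (1/2)-tough. -/

import Mathlib

open SimpleGraph

variable {V : Type*} {W : Type*}

/-- A graph is `P₄`-free if it contains no induced subgraph isomorphic to the
path on four vertices. -/
def P4Free (G : SimpleGraph V) : Prop := IsEmpty (SimpleGraph.pathGraph 4 ↪g G)

/-- `R` is (the vertex set of) a connected component of `G - S`:
a maximal subset of `V(G) - S` inducing a connected subgraph. -/
def IsCompOf (G : SimpleGraph V) (S R : Set V) : Prop :=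
  R ⊆ Sᶜ ∧ (G.induce R).Connected ∧
    ∀ R' : Set V, R ⊆ R' → R' ⊆ Sᶜ → (G.induce R').Connected → R' = R

/-- The number of connected components of `G - S`. -/
noncomputable def numComp (G : SimpleGraph V) (S : Set V) : ℕ :=
  {R : Set V | IsCompOf G S R}.ncard

/-- `S` is a cutset of `G` : the graph `G - S` is disconnected. -/
def IsCutset (G : SimpleGraph V) (S : Set V) : Prop := 2 ≤ numComp G S

/-- `G` is `t`-tough: for every cutset `S`, `t * c(G - S) ≤ |S|`. -/
def Tough (t : ℝ) (G : SimpleGraph V) : Prop :=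
  ∀ S : Set V, IsCutset G S → t * (numComp G S : ℝ) ≤ (S.ncard : ℝ)

/-- `t` is the toughness of `G` : the largest `s` such that `G` is `s`-tough.
(For a complete graph no such largest `s` exists; the toughness is infinite.) -/
def IsToughness (G : SimpleGraph V) (t : ℝ) : Prop :=
  Tough t G ∧ ∀ s : ℝ, Tough s G → s ≤ t

/-- `S` is a tough-set of `G` (whose toughness is `t`): a cutset with
`|S| = t * c(G - S)`. -/
def ToughSet (G : SimpleGraph V) (t : ℝ) (S : Set V) : Prop :=
  IsCutset G S ∧ (S.ncard : ℝ) = t * (numComp G S : ℝ)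

/-- Vertex `u` is adjacent in `G` to some vertex of the set `R`. -/
def AdjToSet (G : SimpleGraph V) (u : V) (R : Set V) : Prop := ∃ v ∈ R, G.Adj u v

/-- `G` has a Hamiltonian cycle. -/
def HasHamCycle [DecidableEq V] (G : SimpleGraph V) : Prop :=
  ∃ (v : V) (w : G.Walk v v), w.IsHamiltonianCycle

/-- `G` has a spanning `k`-walk: a closed walk visiting every vertex at least once
and at most `k` times.  (In a nontrivial closed walk the base vertex occurs one
extra time in `Walk.support`, whence the correction term.) -/
def HasSpanningKWalk [DecidableEq V] (G : SimpleGraph V) (k : ℕ) : Prop :=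
  ∃ (v : V) (w : G.Walk v v), (∀ x : V, x ∈ w.support) ∧
    ∀ x : V, w.support.count x ≤ k + (if x = v then 1 else 0)

/-- The prism over `G`: the Cartesian (box) product `G □ K₂`. -/
def prism (G : SimpleGraph V) : SimpleGraph (V × Fin 2) :=
  G.boxProd (⊤ : SimpleGraph (Fin 2))

/-- The graph obtained from `G` by contracting the set `R` to a single vertex
(namely `Sum.inr ()`), which is adjacent to exactly those vertices outside `R`
having a neighbor in `R`. -/
def contractSet (G : SimpleGraph V) (R : Set V) : SimpleGraph (↥(Rᶜ) ⊕ Unit) :=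
  SimpleGraph.fromRel fun x y =>
    match x, y with
    | Sum.inl a, Sum.inl b => G.Adj ↑a ↑b
    | Sum.inl a, Sum.inr _ => ∃ r ∈ R, G.Adj ↑a r
    | _, _ => False

/-- `v` is a cutvertex of `H` : deleting `v` leaves a disconnected
(non-preconnected) graph. -/
def IsCutvertex (H : SimpleGraph W) (v : W) : Prop :=
  ¬ (H.induce ({v}ᶜ : Set W)).Preconnected

/-- `B` is a block of `H` : a maximal connected subgraph having no cutvertex of
its own. -/
def IsBlock (H : SimpleGraph W) (B : H.Subgraph) : Prop :=
  B.coe.Connected ∧ (∀ v, ¬ IsCutvertex B.coe v) ∧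
    ∀ B' : H.Subgraph, B ≤ B' → B'.coe.Connected →
      (∀ v, ¬ IsCutvertex B'.coe v) → B' = B

/-- `H` is a cycle of even length. -/
def IsEvenCycleGraph (H : SimpleGraph W) : Prop :=
  ∃ n : ℕ, Even n ∧ 3 ≤ n ∧ Nonempty (H ≃g SimpleGraph.cycleGraph n)

/-- `H` is a single edge. -/
def IsSingleEdgeGraph (H : SimpleGraph W) : Prop :=
  ∃ u v : W, u ≠ v ∧ H.Adj u v ∧ ∀ w : W, w = u ∨ w = v

/-- `H` is a simple block EP (SBEP) graph: a connected graph in which every block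
is an even cycle or a single edge, and every vertex lies in at most two blocks. -/
def IsSBEP (H : SimpleGraph W) : Prop :=
  H.Connected ∧
    (∀ B : H.Subgraph, IsBlock H B → IsEvenCycleGraph B.coe ∨ IsSingleEdgeGraph B.coe) ∧
    ∀ (v : W) (B₁ B₂ B₃ : H.Subgraph),
      IsBlock H B₁ ∧ v ∈ B₁.verts → IsBlock H B₂ ∧ v ∈ B₂.verts →
      IsBlock H B₃ ∧ v ∈ B₃.verts → B₁ = B₂ ∨ B₁ = B₃ ∨ B₂ = B₃

/-- `v` is a single-block vertex of `H` : it lies in exactly one block. -/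
def SingleBlockVertex (H : SimpleGraph W) (v : W) : Prop :=
  ∃! B : H.Subgraph, IsBlock H B ∧ v ∈ B.verts

/-- A walk in the prism projects to a walk in the base graph, visiting each vertex at most as often
as the prism walk visits its two copies. -/
lemma exists_walk_of_prism_walk [DecidableEq V] {G : SimpleGraph V} {x y : V × Fin 2}
    (p : (prism G).Walk x y) :
    ∃ q : G.Walk x.1 y.1, (∀ z ∈ p.support, z.1 ∈ q.support) ∧
      ∀ a, q.support.count a ≤ p.support.count (a, 0) + p.support.count (a, 1) := by
  induction p with
  | @nil u =>
    refine ⟨.nil, by simp, fun a => ?_⟩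
    obtain ⟨u, i⟩ := u
    fin_cases i <;> simp [List.count_singleton, Prod.ext_iff]
  | @cons u v w h p ih =>
    obtain ⟨q, hq, hc⟩ := ih
    obtain ⟨u, i⟩ := u
    obtain ⟨v, j⟩ := v
    rw [prism, boxProd_adj] at h
    obtain ⟨h, hij⟩ | ⟨-, h⟩ := h
    · simp only at hij
      subst hij
      have h : G.Adj u v := h
      refine ⟨.cons h q, ?_, fun a => ?_⟩
      · simp only [Walk.support_cons, List.mem_cons]
        rintro z (rfl | hz)
        · exact .inl rfl
        · exact .inr (hq z hz)
      · have := hc a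
        fin_cases i <;> simp [List.count_cons, Prod.ext_iff] <;> grind
    · simp only at h
      subst h
      refine ⟨q, ?_, fun a => ?_⟩
      · simp only [Walk.support_cons, List.mem_cons]
        rintro z (rfl | hz)
        · exact q.start_mem_support
        · exact hq z hz
      · have := hc a
        simp only [Walk.support_cons, List.count_cons]
        omega

lemma hasSpanningKWalk_of_hasHamCycle_prism [DecidableEq V] {G : SimpleGraph V}
    (h : HasHamCycle (prism G)) : HasSpanningKWalk G 2 := by
  obtain ⟨⟨v, i⟩, w, hw⟩ := h
  obtain ⟨q, hq, hc⟩ := exists_walk_of_prism_walk w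
  refine ⟨v, q, fun x => hq (x, 0) (hw.mem_support _), fun x => (hc x).trans ?_⟩
  have key : ∀ j, w.support.count (x, j) = 1 + if (x, j) = (v, i) then 1 else 0 := by
    intro j
    rw [lawful_beq_subsingleton instBEqProd (instBEqOfDecidableEq (α := V × Fin 2))]
    split_ifs with h
    · rw [h]
      exact hw.count_support_self
    · exact hw.support_count_of_ne (Ne.symm h)
  rw [key, key]
  simp only [Prod.mk.injEq]
  by_cases hx : x = v
  · fin_cases i <;> simp [hx]
  · simp [hx]

lemma IsCompOf.mem_of_adj {G : SimpleGraph V} {S R : Set V} (hR : IsCompOf G S R) {x y : V}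
    (hx : x ∈ R) (hxy : G.Adj x y) (hy : y ∉ S) : y ∈ R := by
  have h := induce_union_connected hR.2.1.preconnected
    (induce_pair_connected_of_adj hxy).preconnected ⟨x, hx, by simp⟩
  rw [← hR.2.2 _ Set.subset_union_left ?_ h]
  · simp
  · rintro z (hz | rfl | rfl)
    · exact hR.1 hz
    · exact hR.1 hx
    · exact hy

lemma IsCompOf.eq_of_mem {G : SimpleGraph V} {S R R' : Set V} (hR : IsCompOf G S R)
    (hR' : IsCompOf G S R') {x : V} (hx : x ∈ R) (hx' : x ∈ R') : R = R' := by
  have h := induce_union_connected hR.2.1.preconnected hR'.2.1.preconnected ⟨x, hx, hx'⟩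
  have hS := Set.union_subset hR.1 hR'.1
  rw [← hR.2.2 _ Set.subset_union_left hS h]
  exact hR'.2.2 _ Set.subset_union_right hS h

lemma IsCompOf.nonempty {G : SimpleGraph V} {S R : Set V} (hR : IsCompOf G S R) : R.Nonempty :=
  Set.nonempty_coe_sort.1 hR.2.1.nonempty

lemma exists_isCompOf_mem [Finite V] (G : SimpleGraph V) {S : Set V} {x : V} (hx : x ∉ S) :
    ∃ R, IsCompOf G S R ∧ x ∈ R := by
  obtain ⟨R, hxR, hR⟩ := (Set.toFinite
    {R : Set V | R ⊆ Sᶜ ∧ (G.induce R).Connected}).exists_le_maximal (a := {x}) ⟨by simpa using hx, by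
      have : Subsingleton ({x} : Set V) := inferInstance
      exact ⟨.of_subsingleton⟩⟩
  exact ⟨R, ⟨hR.prop.1, hR.prop.2, fun R' h h₁ h₂ => (hR.eq_of_subset ⟨h₁, h₂⟩ h).symm⟩,
    hxR rfl⟩

lemma IsCompOf.eq_of_adj_eq {α : Type*} {G : SimpleGraph V} {S R : Set V} (hR : IsCompOf G S R)
    {f : V → α} (hf : ∀ x y, x ∉ S → y ∉ S → G.Adj x y → f x = f y) {x y : V}
    (hx : x ∈ R) (hy : y ∈ R) : f x = f y := by
  obtain ⟨p⟩ := hR.2.1.preconnected ⟨x, hx⟩ ⟨y, hy⟩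
  have : ∀ u v : R, (G.induce R).Walk u v → f u = f v := by
    intro u v p
    induction p with
    | nil => rfl
    | cons h p ih => exact (hf _ _ (hR.1 (Subtype.prop _)) (hR.1 (Subtype.prop _)) h).trans ih
  exact this _ _ p

/-- A labelling that is constant along the edges of `G - S` uses at most `c(G - S)` labels. -/
lemma ncard_image_compl_le_numComp [Finite V] {α : Type*} (G : SimpleGraph V) (S : Set V)
    {f : V → α} (hf : ∀ x y, x ∉ S → y ∉ S → G.Adj x y → f x = f y) :
    (f '' Sᶜ).ncard ≤ numComp G S := by
  classical
  have h : ∀ a ∈ f '' Sᶜ, ∃ R, IsCompOf G S R ∧ ∃ x ∈ R, f x = a := by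
    rintro _ ⟨x, hx, rfl⟩
    obtain ⟨R, hR, hxR⟩ := exists_isCompOf_mem G hx
    exact ⟨R, hR, x, hxR, rfl⟩
  choose! g hg hg' using h
  refine Set.ncard_le_ncard_of_injOn g hg (fun a ha b hb hab => ?_) (Set.toFinite _)
  obtain ⟨x, hx, rfl⟩ := hg' a ha
  obtain ⟨y, hy, rfl⟩ := hg' b hb
  rw [← hab] at hy
  exact (hg _ ha).eq_of_adj_eq hf hx hy

lemma IsCompOf.exists_dart {G : SimpleGraph V} [DecidableEq V] {S R : Set V}
    (hR : IsCompOf G S R) {v x : V} (w : G.Walk v v) (hw : ∀ x, x ∈ w.support) (hx : x ∉ R) :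
    ∃ d ∈ w.darts, d.fst ∈ R ∧ d.snd ∈ S := by
  obtain ⟨r, hr⟩ := hR.nonempty
  have hx' : x ∈ (w.rotate r (hw r)).support := by
    rw [Walk.mem_support_rotate_iff]
    exact hw x
  obtain ⟨d, hd, h₁, h₂⟩ := ((w.rotate r (hw r)).takeUntil x hx').exists_boundary_dart R hr hx
  refine ⟨d, (w.rotate_darts r (hw r)).mem_iff.1 (Walk.darts_takeUntil_subset_darts _ _ hd), h₁, ?_⟩
  by_contra h
  exact h₂ (hR.mem_of_adj h₁ d.adj h)

lemma tough_half_of_hasSpanningKWalk [Fintype V] [DecidableEq V] {G : SimpleGraph V}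
    (h : HasSpanningKWalk G 2) : Tough (1 / 2 : ℝ) G := by
  classical
  obtain ⟨v, w, hw, hc⟩ := h
  intro S hS
  have hd : ∀ R ∈ {R | IsCompOf G S R}, ∃ d ∈ w.darts, d.fst ∈ R ∧ d.snd ∈ S := by
    intro R hR
    obtain ⟨R', hR', hne⟩ := Set.exists_ne_of_one_lt_ncard hS R
    obtain ⟨x, hx⟩ := IsCompOf.nonempty hR'
    exact hR.exists_dart w hw fun hxR => hne (hR'.eq_of_mem hR hx hxR)
  have : Nonempty G.Dart := by
    obtain ⟨R, hR⟩ := Set.nonempty_of_ncard_ne_zero (zero_lt_two.trans_le hS).ne'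
    exact ⟨(hd R hR).choose⟩
  choose! d hd hfst hsnd using hd
  let D := w.darts.filter fun d => d.snd ∈ S
  have h₁ : numComp G S ≤ D.toFinset.card := by
    rw [← Set.ncard_coe_finset]
    refine Set.ncard_le_ncard_of_injOn d (fun R hR => ?_) (fun R hR R' hR' hRR => ?_)
      (Set.toFinite _)
    · simpa [D] using ⟨hd R hR, hsnd R hR⟩
    · refine hR.eq_of_mem hR' (hfst R hR) ?_
      rw [hRR]
      exact hfst R' hR'
  let T := w.support.tail.filter (· ∈ S)
  have h₂ : D.length = T.length := by
    simp only [D, T, ← Walk.map_snd_darts, List.filter_map, List.length_map]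
    rfl
  have h₃ : T.length ≤ T.toFinset.card * 2 := by
    rw [← List.sum_toFinset_count_eq_length]
    refine Finset.sum_le_card_nsmul _ _ _ fun x _ => ?_
    refine (List.filter_sublist.count_le x).trans ?_
    have := hc x
    rw [← Walk.cons_tail_support, List.count_cons] at this
    by_cases hx : x = v
    · subst hx; simp at this; omega
    · simp [hx, Ne.symm hx] at this; omega
  have h₄ : T.toFinset.card ≤ S.ncard := by
    rw [← Set.ncard_coe_finset]
    refine Set.ncard_le_ncard (fun x hx => ?_) (Set.toFinite _)
    simp [T] at hx
    exact hx.2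
  have h₅ : numComp G S ≤ 2 * S.ncard := by
    have := D.toFinset_card_le
    omega
  have : (numComp G S : ℝ) ≤ 2 * S.ncard := by exact_mod_cast h₅
  linarith

/-- `l` is the vertex list of a path in the prism that starts in the bottom copy of `E` and ends in
the top copy of `E`. -/
def IsCrossing (G : SimpleGraph V) (E : Finset V) (l : List (V × Fin 2)) : Prop :=
  l.IsChain (prism G).Adj ∧ (∃ u ∈ E, l.head? = some (u, 0)) ∧ ∃ u ∈ E, l.getLast? = some (u, 1)

/-- The prism over `A` can be partitioned into `k` paths, each going from the bottom copy of `E` to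
the top copy of `E`. -/
def HasCrossingCover (G : SimpleGraph V) (A E : Finset V) (k : ℕ) : Prop :=
  ∃ L : List (List (V × Fin 2)), L.length = k ∧ (∀ l ∈ L, IsCrossing G E l) ∧
    L.flatten.Nodup ∧ ∀ x, x ∈ L.flatten ↔ x.1 ∈ A

lemma prism_adj_vertical (G : SimpleGraph V) (v : V) {i j : Fin 2} (h : i ≠ j) :
    (prism G).Adj (v, i) (v, j) := by
  simp [prism, h]

lemma prism_adj_horizontal {G : SimpleGraph V} {u v : V} (h : G.Adj u v) (i : Fin 2) :
    (prism G).Adj (u, i) (v, i) := by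
  simp [prism, h]

lemma isCrossing_singleton (G : SimpleGraph V) (v : V) :
    IsCrossing G {v} [(v, 0), (v, 1)] := by
  simp [IsCrossing, prism_adj_vertical]

section Crossing

variable {G : SimpleGraph V} {A B E E' : Finset V} {p q r : List (V × Fin 2)} {v : V} {k l : ℕ}

lemma IsCrossing.mono (h : IsCrossing G E p) (hE : E ⊆ E') : IsCrossing G E' p := by
  obtain ⟨h, ⟨u, hu, h₁⟩, w, hw, h₂⟩ := h
  exact ⟨h, ⟨u, hE hu, h₁⟩, w, hE hw, h₂⟩

/-- Join two crossing paths through the vertical edge of the prism over `v`. -/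
lemma IsCrossing.join_vertical (hp : IsCrossing G E p) (hq : IsCrossing G E q)
    (hv : ∀ u ∈ E, G.Adj u v) : IsCrossing G E (p ++ (v, 1) :: (v, 0) :: q) := by
  obtain ⟨hp, ⟨a, ha, hpa⟩, b, hb, hpb⟩ := hp
  obtain ⟨hq, ⟨c, hc, hqc⟩, d, hd, hqd⟩ := hq
  refine ⟨?_, ⟨a, ha, by simp [hpa]⟩, d, hd, by simp [List.getLast?_cons, hqd]⟩
  simp [List.isChain_append, List.isChain_cons, hp, hq, hpb, hqc,
    prism_adj_vertical, prism_adj_horizontal (hv _ hb), prism_adj_horizontal (hv _ hc).symm]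

/-- Join three crossing paths through the two copies of `v`, used separately. -/
lemma IsCrossing.join_horizontal (hp : IsCrossing G E p) (hq : IsCrossing G E q)
    (hr : IsCrossing G E r) (hv : ∀ u ∈ E, G.Adj u v) :
    IsCrossing G E (p ++ (v, 1) :: (q.reverse ++ (v, 0) :: r)) := by
  obtain ⟨hp, ⟨a, ha, hpa⟩, b, hb, hpb⟩ := hp
  obtain ⟨hq, ⟨c, hc, hqc⟩, d, hd, hqd⟩ := hq
  obtain ⟨hr, ⟨e, he, hre⟩, f, hf, hrf⟩ := hr
  have hq' : q.reverse.IsChain (prism G).Adj := by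
    rw [List.isChain_reverse]
    exact hq.imp fun _ _ h => h.symm
  refine ⟨?_, ⟨a, ha, by simp [hpa]⟩, f, hf, by simp [List.getLast?_cons, hrf]⟩
  simp [List.isChain_append, List.isChain_cons, hp, hq', hr, hpb, hqc, hqd, hre,
    prism_adj_horizontal (hv _ hb), prism_adj_horizontal (hv _ hc),
    prism_adj_horizontal (hv _ hd).symm, prism_adj_horizontal (hv _ he).symm]

/-- A crossing path contains a vertical edge. -/
lemma exists_vertical_edge : ∀ {p : List (V × Fin 2)} {u w : V}, p.IsChain (prism G).Adj →
    p.head? = some (u, 0) → p.getLast? = some (w, 1) →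
    ∃ s t a, p = s ++ (a, 0) :: (a, 1) :: t
  | [], _, _, _, h, _ => by simp at h
  | [x], _, _, _, h, h' => by simp_all
  | (x, i) :: (y, j) :: t, u, w, hc, h, h' => by
    simp only [List.head?_cons, Option.some.injEq, Prod.mk.injEq] at h
    obtain ⟨rfl, rfl⟩ := h
    rw [List.isChain_cons_cons] at hc
    by_cases hj : j = 0
    · subst hj
      obtain ⟨s, t', a, hs⟩ := exists_vertical_edge hc.2 rfl (by simpa using h')
      exact ⟨(x, 0) :: s, t', a, by rw [hs]; rfl⟩
    · obtain rfl : j = 1 := by omega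
      have := hc.1
      simp [prism] at this
      subst this
      exact ⟨[], t, x, rfl⟩

/-- Insert the prism over `v` into a crossing path, along a vertical edge. -/
lemma IsCrossing.exists_insert (hp : IsCrossing G E p) (hv : ∀ x ∈ p, G.Adj x.1 v) :
    ∃ q, q.Perm ((v, 0) :: (v, 1) :: p) ∧ IsCrossing G E q := by
  obtain ⟨hp, ⟨a, ha, hpa⟩, b, hb, hpb⟩ := hp
  obtain ⟨s, t, c, rfl⟩ := exists_vertical_edge hp hpa hpb
  have hc : G.Adj c v := hv (c, 0) (by simp)
  refine ⟨s ++ (c, 0) :: (v, 0) :: (v, 1) :: (c, 1) :: t, ?_, ?_, ⟨a, ha, ?_⟩, b, hb, ?_⟩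
  · classical
    rw [List.perm_iff_count]
    intro x
    simp only [List.count_append, List.count_cons]
    omega
  · rw [List.isChain_append_cons_cons] at hp ⊢
    simp [hp, prism_adj_vertical, prism_adj_horizontal hc, prism_adj_horizontal hc.symm]
  · rw [← hpa]; cases s <;> simp
  · rw [← hpb]; simp

lemma HasCrossingCover.of_perm [DecidableEq V] {L M : List (List (V × Fin 2))}
    (hL : ∀ l ∈ M, IsCrossing G E l) (hv : v ∉ A) (hn : L.flatten.Nodup)
    (hm : ∀ x, x ∈ L.flatten ↔ x.1 ∈ A)
    (hp : M.flatten.Perm ((v, 0) :: (v, 1) :: L.flatten)) :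
    HasCrossingCover G (insert v A) E M.length := by
  refine ⟨M, rfl, hL, ?_, ?_⟩
  · rw [hp.nodup_iff]
    simp only [List.nodup_cons, List.mem_cons, hm]
    simp [hv, hn]
  · rintro ⟨x, i⟩
    rw [hp.mem_iff]
    simp only [List.mem_cons, hm, Finset.mem_insert]
    fin_cases i <;> simp

lemma HasCrossingCover.join_vertical [DecidableEq V] (h : HasCrossingCover G A E (k + 2))
    (hv : v ∉ A) (hE : ∀ u ∈ E, G.Adj u v) : HasCrossingCover G (insert v A) E (k + 1) := by
  obtain ⟨_ | ⟨p, _ | ⟨q, L⟩⟩, hL, hc, hn, hm⟩ := h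
  · simp at hL
  · simp at hL
  simp only [List.length_cons, add_left_inj, List.mem_cons, forall_eq_or_imp] at hL hc
  have := HasCrossingCover.of_perm (G := G) (E := E)
    (M := (p ++ (v, 1) :: (v, 0) :: q) :: L) ?_ hv hn hm ?_
  · simpa [hL] using this
  · simp only [List.mem_cons, forall_eq_or_imp]
    exact ⟨hc.1.join_vertical hc.2.1 hE, hc.2.2⟩
  · rw [List.perm_iff_count]
    intro x
    simp only [List.flatten_cons, List.count_append, List.count_cons]
    omega

lemma HasCrossingCover.join_horizontal [DecidableEq V] (h : HasCrossingCover G A E (k + 3))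
    (hv : v ∉ A) (hE : ∀ u ∈ E, G.Adj u v) : HasCrossingCover G (insert v A) E (k + 1) := by
  obtain ⟨_ | ⟨p, _ | ⟨q, _ | ⟨r, L⟩⟩⟩, hL, hc, hn, hm⟩ := h
  · simp at hL
  · simp at hL
  · simp at hL
  simp only [List.length_cons, add_left_inj, List.mem_cons, forall_eq_or_imp] at hL hc
  have := HasCrossingCover.of_perm (G := G) (E := E)
    (M := (p ++ (v, 1) :: (q.reverse ++ (v, 0) :: r)) :: L) ?_ hv hn hm ?_
  · simpa [hL] using this
  · simp only [List.mem_cons, forall_eq_or_imp]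
    exact ⟨hc.1.join_horizontal hc.2.1 hc.2.2.1 hE, hc.2.2.2⟩
  · rw [List.perm_iff_count]
    intro x
    simp only [List.flatten_cons, List.count_append, List.count_cons, List.count_reverse]
    omega

lemma HasCrossingCover.insert_same [DecidableEq V] (h : HasCrossingCover G A E (k + 1))
    (hv : v ∉ A) (hA : ∀ u ∈ A, G.Adj u v) : HasCrossingCover G (insert v A) E (k + 1) := by
  obtain ⟨_ | ⟨p, L⟩, hL, hc, hn, hm⟩ := h
  · simp at hL
  simp only [List.length_cons, add_left_inj, List.mem_cons, forall_eq_or_imp] at hL hc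
  obtain ⟨q, hq, hqc⟩ := hc.1.exists_insert (v := v) fun x hx => hA _ ((hm x).1 (by simp [hx]))
  have := HasCrossingCover.of_perm (G := G) (E := E) (M := q :: L) ?_ hv hn hm ?_
  · simpa [hL] using this
  · simp only [List.mem_cons, forall_eq_or_imp]
    exact ⟨hqc, hc.2⟩
  · simpa using hq.append_right L.flatten

lemma hasCrossingCover_singleton (G : SimpleGraph V) (v : V) : HasCrossingCover G {v} {v} 1 := by
  refine ⟨[[(v, 0), (v, 1)]], rfl, by simpa using isCrossing_singleton G v, by simp, ?_⟩
  rintro ⟨x, i⟩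
  fin_cases i <;> simp

lemma HasCrossingCover.union [DecidableEq V] (hA : HasCrossingCover G A A k)
    (hB : HasCrossingCover G B B l) (h : Disjoint A B) :
    HasCrossingCover G (A ∪ B) (A ∪ B) (k + l) := by
  obtain ⟨L, rfl, hc, hn, hm⟩ := hA
  obtain ⟨L', rfl, hc', hn', hm'⟩ := hB
  refine ⟨L ++ L', by simp, fun l hl => ?_, ?_, fun x => ?_⟩
  · obtain hl | hl := List.mem_append.1 hl
    · exact (hc l hl).mono Finset.subset_union_left
    · exact (hc' l hl).mono Finset.subset_union_right
  · rw [List.flatten_append, List.nodup_append]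
    refine ⟨hn, hn', fun x hx y hy hxy => ?_⟩
    subst hxy
    exact Finset.disjoint_left.1 h ((hm x).1 hx) ((hm' x).1 hy)
  · simp [-List.mem_flatten, hm, hm']

lemma HasCrossingCover.le_self (h : HasCrossingCover G A E k) : HasCrossingCover G A A k := by
  obtain ⟨L, hL, hc, hn, hm⟩ := h
  refine ⟨L, hL, fun l hl => ?_, hn, hm⟩
  obtain ⟨h, ⟨u, hu, h₁⟩, w, hw, h₂⟩ := hc l hl
  exact ⟨h, ⟨u, (hm (u, 0)).1 (List.mem_flatten_of_mem hl (List.mem_of_head? h₁)), h₁⟩,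
    w, (hm (w, 1)).1 (List.mem_flatten_of_mem hl (List.mem_of_getLast? h₂)), h₂⟩

/-- Every vertex of `T` merges two or three of the crossing paths into one. -/
lemma HasCrossingCover.join_finset [DecidableEq V] (T : Finset V) :
    ∀ {A : Finset V} {j : ℕ}, HasCrossingCover G A E j → Disjoint A T →
    (∀ u ∈ E, ∀ v ∈ T, G.Adj u v) → 1 ≤ k → k + T.card ≤ j → j ≤ k + 2 * T.card →
    HasCrossingCover G (A ∪ T) E k := by
  induction T using Finset.induction_on with
  | empty =>
    intro A j h _ _ _ h₁ h₂
    obtain rfl : j = k := by simp at h₁ h₂; omega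
    simpa using h
  | insert v T hvT ih =>
    intro A j h hA hE hk h₁ h₂
    rw [Finset.card_insert_of_notMem hvT] at h₁ h₂
    rw [Finset.disjoint_insert_right] at hA
    have hd : Disjoint (insert v A) T := Finset.disjoint_insert_left.2 ⟨hvT, hA.2⟩
    have hv : ∀ u ∈ E, G.Adj u v := fun u hu => hE u hu v (by simp)
    have hT : ∀ u ∈ E, ∀ v ∈ T, G.Adj u v := fun u hu v hv => hE u hu v (by simp [hv])
    rw [Finset.union_insert, ← Finset.insert_union]
    obtain h₃ | h₃ := Nat.lt_or_ge (k + T.card + 1) j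
    · obtain ⟨i, rfl⟩ : ∃ i, j = i + 3 := ⟨j - 3, by omega⟩
      exact ih (h.join_horizontal hA.1 hv) hd hT hk (by omega) (by omega)
    · obtain ⟨i, rfl⟩ : ∃ i, j = i + 2 := ⟨j - 2, by omega⟩
      exact ih (h.join_vertical hA.1 hv) hd hT hk (by omega) (by omega)

/-- Every vertex of `T` contributes its own vertical edge as a crossing path. -/
lemma HasCrossingCover.add_finset [DecidableEq V] (h : HasCrossingCover G A A k) (T : Finset V)
    (hT : Disjoint A T) : HasCrossingCover G (A ∪ T) (A ∪ T) (k + T.card) := by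
  induction T using Finset.induction_on with
  | empty => simpa using h
  | insert v T hvT ih =>
    rw [Finset.disjoint_insert_right] at hT
    have := (ih hT.2).union (hasCrossingCover_singleton G v) (by simp [hT.1, hvT])
    rw [Finset.card_insert_of_notMem hvT, Finset.union_insert, Finset.insert_eq,
      Finset.union_comm {v}]
    exact this

end Crossing

lemma hasHamCycle_of_isChain {W : Type*} [Fintype W] [DecidableEq W] {H : SimpleGraph W}
    {l : List W} (hc : l.IsChain H.Adj) (hn : l.Nodup) (hm : ∀ x, x ∈ l) {a b : W}
    (ha : l.head? = some a) (hb : l.getLast? = some b) (hba : H.Adj b a)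
    (hW : 3 ≤ Fintype.card W) : HasHamCycle H := by
  have hne : l ≠ [] := by rintro rfl; simp at ha
  obtain rfl : l.head hne = a := by simpa [List.head?_eq_some_head hne] using ha
  obtain rfl : l.getLast hne = b := by simpa [List.getLast?_eq_some_getLast hne] using hb
  have hp : (Walk.ofSupport l hne hc).IsPath := by
    rw [Walk.isPath_def, Walk.support_ofSupport]
    exact hn
  have hh := hp.isHamiltonian_of_mem (by simpa using hm)
  refine ⟨_, .cons hba (Walk.ofSupport l hne hc), ?_⟩
  rw [Walk.isHamiltonianCycle_isCycle_and_isHamiltonian_tail,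
    Walk.isCycle_iff_isPath_tail_and_le_length]
  refine ⟨⟨by simpa using hp, ?_⟩, by simpa [Walk.IsHamiltonian] using hh⟩
  have := hh.length_eq
  simp only [Walk.length_cons]
  omega

/-- The last vertex `v` closes one or two crossing paths to a Hamiltonian cycle. -/
lemma HasCrossingCover.hasHamCycle_prism [Fintype V] [DecidableEq V] {G : SimpleGraph V}
    {A E : Finset V} {k : ℕ} {v : V} (hV : 2 ≤ Fintype.card V) (h : HasCrossingCover G A E k)
    (hk : 1 ≤ k) (hk' : k ≤ 2) (hA : insert v A = Finset.univ) (hv : v ∉ A)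
    (hE : ∀ u ∈ E, G.Adj u v) : HasHamCycle (prism G) := by
  obtain ⟨L, hL, hc, hn, hm⟩ := h
  have hcard : 3 ≤ Fintype.card (V × Fin 2) := by simp; omega
  have main : ∀ M : List (V × Fin 2), M.Perm ((v, 0) :: (v, 1) :: L.flatten) →
      M.Nodup ∧ ∀ x, x ∈ M := by
    intro M hp
    refine ⟨?_, ?_⟩
    · rw [hp.nodup_iff]
      simp only [List.nodup_cons, List.mem_cons, hm]
      simp [hv, hn]
    · rintro ⟨x, i⟩
      have hx : x ∈ insert v A := hA ▸ Finset.mem_univ x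
      rw [hp.mem_iff]
      simp only [List.mem_cons, hm]
      rw [Finset.mem_insert] at hx
      fin_cases i <;> simp [hx]
  obtain rfl | rfl : k = 1 ∨ k = 2 := by omega
  · obtain ⟨p, rfl⟩ := List.length_eq_one_iff.1 hL
    obtain ⟨hp, ⟨a, ha, hpa⟩, b, hb, hpb⟩ := hc p (by simp)
    obtain ⟨hn', hm'⟩ := main (p ++ [(v, 1), (v, 0)]) (by
      rw [List.perm_iff_count]
      intro x
      simp only [List.flatten_cons, List.count_append, List.count_cons, List.flatten_nil,
        List.count_nil]
      omega)
    refine hasHamCycle_of_isChain ?_ hn' hm' (a := (a, 0)) (b := (v, 0)) (by simp [hpa])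
      (by simp) (prism_adj_horizontal (hE a ha).symm 0) hcard
    simp [List.isChain_append, hp, hpb, prism_adj_vertical, prism_adj_horizontal (hE b hb)]
  · obtain ⟨p, q, rfl⟩ := List.length_eq_two.1 hL
    obtain ⟨hp, ⟨a, ha, hpa⟩, b, hb, hpb⟩ := hc p (by simp)
    obtain ⟨hq, ⟨c, hc, hqc⟩, d, hd, hqd⟩ := hc q (by simp)
    obtain ⟨hn', hm'⟩ := main (p ++ (v, 1) :: (q.reverse ++ [(v, 0)])) (by
      rw [List.perm_iff_count]
      intro x
      simp only [List.flatten_cons, List.count_append, List.count_cons, List.flatten_nil,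
        List.count_nil, List.count_reverse]
      omega)
    have hq' : q.reverse.IsChain (prism G).Adj := by
      rw [List.isChain_reverse]
      exact hq.imp fun _ _ h => h.symm
    refine hasHamCycle_of_isChain ?_ hn' hm' (a := (a, 0)) (b := (v, 0)) (by simp [hpa])
      (by simp [List.getLast?_cons]) (prism_adj_horizontal (hE a ha).symm 0) hcard
    simp [List.isChain_append, List.isChain_cons, hp, hq', hpb, hqc, hqd,
      prism_adj_horizontal (hE b hb), prism_adj_horizontal (hE c hc),
      prism_adj_horizontal (hE d hd).symm]

/-- There is no induced path `a b c d`, stated in terms of adjacency. -/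
def NoInducedP4 (G : SimpleGraph V) : Prop :=
  ∀ a b c d, G.Adj a b → G.Adj b c → G.Adj c d → ¬ G.Adj a c → ¬ G.Adj b d → ¬ G.Adj a d → False

lemma P4Free.noInducedP4 {G : SimpleGraph V} (h : P4Free G) : NoInducedP4 G := by
  intro a b c d hab hbc hcd hac hbd had
  have h₁ : a ≠ c := by rintro rfl; exact had hcd
  have h₂ : b ≠ d := by rintro rfl; exact had hab
  have h₃ : a ≠ d := by rintro rfl; exact hac hcd.symm
  refine h.false ⟨⟨![a, b, c, d], ?_⟩, ?_⟩
  · intro i j hij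
    fin_cases i <;> fin_cases j <;>
      simp_all [hab.ne, hbc.ne, hcd.ne, hab.ne', hbc.ne', hcd.ne', h₁.symm, h₂.symm, h₃.symm]
  · intro i j
    change G.Adj (![a, b, c, d] i) (![a, b, c, d] j) ↔ _
    fin_cases i <;> fin_cases j <;>
      simp [pathGraph_adj, hab, hbc, hcd, hac, hbd, had, hab.symm, hbc.symm, hcd.symm,
        mt Adj.symm hac, mt Adj.symm hbd, mt Adj.symm had]

lemma NoInducedP4.compl {G : SimpleGraph V} (h : NoInducedP4 G) : NoInducedP4 Gᶜ := by
  intro a b c d hab hbc hcd hac hbd had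
  have h₁ : a ≠ c := by rintro rfl; exact had hcd
  have h₂ : b ≠ d := by rintro rfl; exact had hab
  have h₃ : a ≠ d := by rintro rfl; exact hac hcd.symm
  simp only [compl_adj, h₁, h₂, h₃, ne_eq, not_false_eq_true, true_and, not_not] at *
  exact h b d a c hbd had.symm hac (fun h => hab.2 h.symm) (fun h => hcd.2 h.symm) hbc.2

/-- `A` is the union of two nonempty disjoint sets with no edges between them. -/
def Splits (G : SimpleGraph V) (A : Finset V) : Prop :=
  ∃ B C : Finset V, B.Nonempty ∧ C.Nonempty ∧ Disjoint B C ∧ (B : Set V) ∪ C = A ∧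
    ∀ x ∈ B, ∀ y ∈ C, ¬ G.Adj x y

lemma NoInducedP4.splits_insert_of_not_adj [DecidableEq V] {G : SimpleGraph V}
    (h : NoInducedP4 G) {B C : Finset V} {v y z : V} (hBC : Disjoint B C) (hvB : v ∉ B)
    (hN : ∀ x ∈ B, ∀ y ∈ C, ¬ G.Adj x y) (hy : y ∈ B) (hvy : ¬ G.Adj v y) (hz : z ∈ C)
    (hvz : G.Adj v z) : Splits G (insert v (B ∪ C)) := by
  classical
  rw [Finset.disjoint_left] at hBC
  refine ⟨B.filter (¬ G.Adj v ·), insert v (C ∪ B.filter (G.Adj v ·)), ⟨y, by simp [hy, hvy]⟩,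
    by simp, ?_, ?_, ?_⟩
  · rw [Finset.disjoint_left]
    grind
  · rw [← Finset.coe_union, Finset.coe_inj]
    ext x
    simp only [Finset.mem_union, Finset.mem_filter, Finset.mem_insert]
    tauto
  · intro x hx w hw hxw
    simp only [Finset.mem_filter, Finset.mem_insert, Finset.mem_union] at hx hw
    obtain rfl | hw | hw := hw
    · exact hx.2 hxw.symm
    · exact hN x hx.1 w hw hxw
    · exact h x w v z hxw hw.2.symm hvz (fun h => hx.2 h.symm) (hN w hw.1 z hz) (hN x hx.1 z hz)

lemma NoInducedP4.splits_insert [DecidableEq V] {G : SimpleGraph V} (h : NoInducedP4 G)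
    {A : Finset V} {v : V} (hA : Splits G A) (hv : v ∉ A) :
    Splits G (insert v A) ∨ Splits Gᶜ (insert v A) := by
  obtain ⟨B, C, hB, hC, hBC, hU, hN⟩ := hA
  rw [← Finset.coe_union, Finset.coe_inj] at hU
  subst hU
  have hN' : ∀ x ∈ C, ∀ y ∈ B, ¬ G.Adj x y := fun x hx y hy h => hN y hy x hx h.symm
  simp only [Finset.mem_union, not_or] at hv
  by_cases h₁ : ∀ x ∈ B, ¬ G.Adj v x
  · refine .inl ⟨insert v C, B, by simp, hB, ?_, ?_, ?_⟩
    · simp [hv, hBC.symm]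
    · rw [← Finset.coe_union, Finset.coe_inj, Finset.insert_union, Finset.union_comm]
    · simpa using ⟨h₁, hN'⟩
  by_cases h₂ : ∀ x ∈ C, ¬ G.Adj v x
  · refine .inl ⟨insert v B, C, by simp, hC, ?_, ?_, ?_⟩
    · simp [hv, hBC]
    · rw [← Finset.coe_union, Finset.coe_inj, Finset.insert_union]
    · simpa using ⟨h₂, hN⟩
  push Not at h₁ h₂
  obtain ⟨b, hb, hvb⟩ := h₁
  obtain ⟨c, hc, hvc⟩ := h₂
  by_cases h₃ : ∀ x ∈ B ∪ C, G.Adj v x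
  · refine .inr ⟨{v}, B ∪ C, by simp, ⟨b, by simp [hb]⟩, by simp [hv], ?_, ?_⟩
    · rw [← Finset.coe_union, Finset.coe_inj, Finset.insert_eq]
    · intro x hx y hy hxy
      obtain rfl := Finset.mem_singleton.1 hx
      exact hxy.2 (h₃ y hy)
  push Not at h₃
  obtain ⟨y, hy, hvy⟩ := h₃
  obtain hy | hy := Finset.mem_union.1 hy
  · exact .inl (h.splits_insert_of_not_adj hBC hv.1 hN hy hvy hc hvc)
  · rw [Finset.union_comm]
    exact .inl (h.splits_insert_of_not_adj hBC.symm hv.2 hN' hy hvy hb hvb)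

/-- Seinsche's theorem: in a `P₄`-free graph, every set of at least two vertices is disconnected
in the graph or in its complement. -/
lemma NoInducedP4.splits_or_splits_compl [DecidableEq V] {G : SimpleGraph V} (h : NoInducedP4 G)
    (A : Finset V) (hA : 2 ≤ A.card) : Splits G A ∨ Splits Gᶜ A := by
  induction A using Finset.induction_on with
  | empty => simp at hA
  | insert v B hv ih =>
    obtain hB | hB := Nat.lt_or_ge B.card 2
    · rw [Finset.card_insert_of_notMem hv] at hA
      obtain ⟨w, rfl⟩ := Finset.card_eq_one.1 (by omega : B.card = 1)
      have : ∀ H : SimpleGraph V, ¬ H.Adj v w → Splits H (insert v {w}) := fun H hH =>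
        ⟨{v}, {w}, by simp, by simp, by simpa using hv, by simp [Set.pair_comm], by simpa using hH⟩
      by_cases hvw : G.Adj v w
      · exact .inr (this _ fun h => h.2 hvw)
      · exact .inl (this _ hvw)
    · obtain h' | h' := ih hB
      · exact h.splits_insert h' hv
      · have := h.compl.splits_insert h' hv
        rw [compl_compl] at this
        exact this.symm

/-- `A` has scattering witness `s`: deleting some `S ⊆ A` leaves at least `s + 2|S|` parts of `A`
that are pairwise not joined by edges, the parts being given by their labels under `f`. -/
def IsScattered [DecidableEq V] (G : SimpleGraph V) (A : Finset V) (s : ℕ) : Prop :=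
  ∃ S ⊆ A, ∃ f : V → V, (∀ x ∈ A, f x ∈ A) ∧
    (∀ x ∈ A \ S, ∀ y ∈ A \ S, G.Adj x y → f x = f y) ∧
    s + 2 * S.card ≤ ((A \ S).image f).card

lemma isScattered_one [DecidableEq V] (G : SimpleGraph V) {A : Finset V} (hA : A.Nonempty) :
    IsScattered G A 1 := by
  obtain ⟨a, ha⟩ := hA
  refine ⟨∅, by simp, fun _ => a, fun _ _ => ha, fun _ _ _ _ _ => rfl, ?_⟩
  simpa using ⟨a, ha⟩

lemma IsScattered.union [DecidableEq V] {G : SimpleGraph V} {A B : Finset V} {s t : ℕ}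
    (hA : IsScattered G A s) (hB : IsScattered G B t) (hAB : Disjoint A B)
    (hN : ∀ x ∈ A, ∀ y ∈ B, ¬ G.Adj x y) : IsScattered G (A ∪ B) (s + t) := by
  obtain ⟨S, hS, f, hf, hfa, hs⟩ := hA
  obtain ⟨T, hT, g, hg, hga, ht⟩ := hB
  have hd := Finset.disjoint_left.1 hAB
  have hN' : ∀ x ∈ B, ∀ y ∈ A, ¬ G.Adj x y := fun x hx y hy h => hN y hy x hx h.symm
  refine ⟨S ∪ T, Finset.union_subset_union hS hT, fun x => if x ∈ A then f x else g x, ?_, ?_, ?_⟩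
  · grind
  · grind
  · rw [Finset.card_union_of_disjoint (hAB.mono hS hT)]
    have hsub : (A \ S).image f ∪ (B \ T).image g ⊆
        ((A ∪ B) \ (S ∪ T)).image fun x => if x ∈ A then f x else g x := by
      intro z
      simp only [Finset.mem_union, Finset.mem_image]
      rintro (⟨x, hx, rfl⟩ | ⟨x, hx, rfl⟩)
      · exact ⟨x, by grind, by grind⟩
      · exact ⟨x, by grind, by grind⟩
    have hdis : Disjoint ((A \ S).image f) ((B \ T).image g) := by
      rw [Finset.disjoint_left]
      grind
    have := Finset.card_le_card hsub
    rw [Finset.card_union_of_disjoint hdis] at this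
    omega

lemma IsScattered.union_separator [DecidableEq V] {G : SimpleGraph V} {A B : Finset V} {s : ℕ}
    (hA : IsScattered G A (s + 2 * B.card)) (hAB : Disjoint A B) : IsScattered G (A ∪ B) s := by
  obtain ⟨S, hS, f, hf, hfa, hs⟩ := hA
  have hd := Finset.disjoint_left.1 hAB
  have hAS : (A ∪ B) \ (S ∪ B) = A \ S := by grind
  refine ⟨S ∪ B, Finset.union_subset_union_left hS, fun x => if x ∈ A then f x else x, ?_, ?_, ?_⟩
  · grind
  · grind
  · rw [Finset.card_union_of_disjoint (hAB.mono_left hS), hAS]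
    have : (A \ S).image (fun x => if x ∈ A then f x else x) = (A \ S).image f :=
      Finset.image_congr fun x hx => by grind
    rw [this]
    omega

lemma IsScattered.le_two_mul_card [Fintype V] [DecidableEq V] {G : SimpleGraph V} {A B : Finset V}
    {s : ℕ} (hA : IsScattered G A s) (hG : Tough (1 / 2 : ℝ) G) (hU : A ∪ B = Finset.univ)
    (hAB : Disjoint A B) (hB : 2 ≤ s ∨ B.Nonempty) : s ≤ 2 * B.card := by
  obtain ⟨S, hS, f, -, hfa, hs⟩ := hA
  have hd := Finset.disjoint_left.1 hAB
  have hcompl : ((S ∪ B : Finset V) : Set V)ᶜ = (A \ S : Finset V) := by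
    rw [← Finset.coe_compl, Finset.coe_inj]
    ext x
    have : x ∈ A ∪ B := hU ▸ Finset.mem_univ x
    rw [Finset.mem_compl]
    grind
  have hmem : ∀ x, x ∉ ((S ∪ B : Finset V) : Set V) → x ∈ A \ S := fun x hx => by
    rw [← Finset.mem_coe, ← hcompl]; exact hx
  have h := ncard_image_compl_le_numComp G ((S ∪ B : Finset V) : Set V) (f := f)
    fun x y hx hy => hfa x (hmem x hx) y (hmem y hy)
  rw [hcompl, ← Finset.coe_image, Set.ncard_coe_finset] at h
  rw [← Finset.card_pos] at hB
  by_contra! hlt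
  have ht := hG ((S ∪ B : Finset V) : Set V) (show 2 ≤ _ by omega)
  rw [Set.ncard_coe_finset, Finset.card_union_of_disjoint (hAB.mono_left hS)] at ht
  have : (numComp G ((S ∪ B : Finset V) : Set V) : ℝ) ≤ ((2 * (S.card + B.card) : ℕ) : ℝ) := by
    push_cast at ht ⊢
    linarith
  have := Nat.cast_le.1 this
  omega

lemma HasCrossingCover.join [DecidableEq V] {G : SimpleGraph V} {A B : Finset V} {s k : ℕ}
    (hA : ∀ j, s ≤ j → j ≤ A.card → HasCrossingCover G A A j) (hs : 1 ≤ s) (hsA : s ≤ A.card)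
    (hAB : Disjoint A B) (hadj : ∀ x ∈ A, ∀ y ∈ B, G.Adj x y) (hBA : B.card ≤ A.card)
    (hk : 1 ≤ k) (hsk : s ≤ k + 2 * B.card) (hkc : k ≤ A.card + B.card) :
    HasCrossingCover G (A ∪ B) (A ∪ B) k := by
  obtain ⟨j, m, c, z, h₁, h₂, h₃, h₄, h₅, h₆, h₇⟩ : ∃ j m c z, s ≤ j ∧ j ≤ A.card ∧ z ≤ 1 ∧
      z + m + c = B.card ∧ c < k ∧ k - c + m ≤ j ∧ j ≤ k - c + 2 * m := by
    set a := A.card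
    set b := B.card
    by_cases h : k + b ≤ a
    · exact ⟨max s (k + b), b, 0, 0, by omega⟩
    by_cases h' : a ≤ k
    · exact ⟨a, (b - (k - a)) / 2, (b + (k - a)) / 2, (b - (k - a)) % 2, by omega⟩
    · exact ⟨a, (b + (a - k)) / 2, (b - (a - k)) / 2, (b - (a - k)) % 2, by omega⟩
  obtain ⟨C, hCB, hC⟩ := Finset.exists_subset_card_eq (by omega : c ≤ B.card)
  have hBC : (B \ C).card = z + m := by rw [Finset.card_sdiff_of_subset hCB]; omega
  obtain ⟨T, hTB, hT⟩ := Finset.exists_subset_card_eq (by omega : m ≤ (B \ C).card)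
  have hZ : ((B \ C) \ T).card = z := by rw [Finset.card_sdiff_of_subset hTB]; omega
  have hd := Finset.disjoint_left.1 hAB
  have key : ∀ Z : Finset V, Z = (B \ C) \ T → HasCrossingCover G (A ∪ Z) A j := by
    intro Z hZ'
    obtain hz | hz : z = 0 ∨ z = 1 := by omega
    · obtain rfl : Z = ∅ := by rw [← Finset.card_eq_zero, hZ', hZ, hz]
      simpa using hA j h₁ h₂
    · obtain ⟨v, rfl⟩ : ∃ v, Z = {v} := by rw [← Finset.card_eq_one, hZ', hZ, hz]
      have hvB : v ∈ B := by
        have : v ∈ (B \ C) \ T := by simp [← hZ']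
        grind
      obtain ⟨i, rfl⟩ : ∃ i, j = i + 1 := ⟨j - 1, by omega⟩
      rw [Finset.union_comm, ← Finset.insert_eq]
      exact (hA _ h₁ h₂).insert_same (fun h => hd h hvB) fun u hu => hadj u hu v hvB
  have h := (key _ rfl).join_finset (k := k - c) T (by rw [Finset.disjoint_left]; grind)
    (fun u hu v hv => hadj u hu v (by grind)) (by omega) (by omega) (by omega)
  have h := h.le_self.add_finset C (by rw [Finset.disjoint_left]; grind)
  rw [hC, Nat.sub_add_cancel h₅.le] at h
  have hU : A ∪ (B \ C) \ T ∪ T ∪ C = A ∪ B := by grind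
  rwa [hU] at h

/-- A tight family of crossing covers: all sizes from the scattering number up to `|A|` occur. -/
lemma NoInducedP4.exists_isScattered_and_hasCrossingCover [DecidableEq V] {G : SimpleGraph V}
    (h : NoInducedP4 G) : ∀ (n : ℕ) (A : Finset V), A.card = n → A.Nonempty →
    ∃ s, 1 ≤ s ∧ s ≤ A.card ∧ IsScattered G A s ∧
      ∀ k, s ≤ k → k ≤ A.card → HasCrossingCover G A A k := by
  intro n
  induction n using Nat.strong_induction_on with
  | _ n ih =>
    rintro A rfl hA
    obtain hA' | hA' := Nat.lt_or_ge A.card 2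
    · have := hA.card_pos
      obtain ⟨v, rfl⟩ := Finset.card_eq_one.1 (by omega : A.card = 1)
      refine ⟨1, le_rfl, by simp, isScattered_one G hA, fun k h₁ h₂ => ?_⟩
      obtain rfl : k = 1 := by simp at h₂; omega
      exact hasCrossingCover_singleton G v
    obtain hS | hS := h.splits_or_splits_compl A hA'
    · obtain ⟨B, C, hB, hC, hBC, hU, hN⟩ := hS
      rw [← Finset.coe_union, Finset.coe_inj] at hU
      subst hU
      have hcard := Finset.card_union_of_disjoint hBC
      have hB' := hB.card_pos
      have hC' := hC.card_pos
      obtain ⟨s, hs, hsB, hss, hsc⟩ := ih B.card (by omega) B rfl hB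
      obtain ⟨t, ht, htC, hts, htc⟩ := ih C.card (by omega) C rfl hC
      refine ⟨s + t, by omega, by omega, hss.union hts hBC hN, fun k h₁ h₂ => ?_⟩
      have := (hsc (min B.card (k - t)) (by omega) (by omega)).union
        (htc (k - min B.card (k - t)) (by omega) (by omega)) hBC
      rwa [show min B.card (k - t) + (k - min B.card (k - t)) = k by omega] at this
    · obtain ⟨B, C, hB, hC, hBC, hU, hN⟩ := hS
      rw [← Finset.coe_union, Finset.coe_inj] at hU
      subst hU
      have key : ∀ B C : Finset V, B.Nonempty → C.Nonempty → Disjoint B C →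
          (∀ x ∈ B, ∀ y ∈ C, ¬ Gᶜ.Adj x y) → C.card ≤ B.card → B.card < (B ∪ C).card →
          (∀ m < (B ∪ C).card, ∀ A : Finset V, A.card = m → A.Nonempty →
            ∃ s, 1 ≤ s ∧ s ≤ A.card ∧ IsScattered G A s ∧
              ∀ k, s ≤ k → k ≤ A.card → HasCrossingCover G A A k) →
          ∃ s, 1 ≤ s ∧ s ≤ (B ∪ C).card ∧ IsScattered G (B ∪ C) s ∧
            ∀ k, s ≤ k → k ≤ (B ∪ C).card → HasCrossingCover G (B ∪ C) (B ∪ C) k := by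
        intro B C hB hC hBC hN hCB hlt ih
        have hcard := Finset.card_union_of_disjoint hBC
        have hadj : ∀ x ∈ B, ∀ y ∈ C, G.Adj x y := fun x hx y hy => by
          by_contra h
          exact hN x hx y hy ⟨fun h => Finset.disjoint_left.1 hBC hx (h ▸ hy), h⟩
        obtain ⟨s, hs, hsB, hss, hsc⟩ := ih B.card hlt B rfl hB
        refine ⟨max 1 (s - 2 * C.card), by omega, by omega, ?_, fun k h₁ h₂ =>
          HasCrossingCover.join hsc hs hsB hBC hadj hCB (by omega) (by omega) (by omega)⟩
        obtain h' | h' := Nat.lt_or_ge (2 * C.card) s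
        · rw [max_eq_right (by omega)]
          refine IsScattered.union_separator ?_ hBC
          rwa [Nat.sub_add_cancel h'.le]
        · rw [max_eq_left (by omega)]
          exact isScattered_one G (hB.mono Finset.subset_union_left)
      have hcard := Finset.card_union_of_disjoint hBC
      have hB' := hB.card_pos
      have hC' := hC.card_pos
      obtain hle | hle := le_total C.card B.card
      · exact key B C hB hC hBC hN hle (by omega) ih
      · rw [Finset.union_comm] at ih hcard ⊢
        exact key C B hC hB hBC.symm (fun x hx y hy h => hN y hy x hx h.symm) hle (by omega) ih

lemma hasHamCycle_prism_of_join [Fintype V] [DecidableEq V] {G : SimpleGraph V}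
    (hcard : 2 ≤ Fintype.card V) (hP : NoInducedP4 G) (hG : Tough (1 / 2 : ℝ) G)
    {A B : Finset V} (hA : A.Nonempty) (hB : B.Nonempty) (hAB : Disjoint A B)
    (hU : A ∪ B = Finset.univ) (hadj : ∀ x ∈ A, ∀ y ∈ B, G.Adj x y) (hBA : B.card ≤ A.card) :
    HasHamCycle (prism G) := by
  obtain ⟨s, hs, hsA, hsc, hcov⟩ := hP.exists_isScattered_and_hasCrossingCover _ A rfl hA
  have hsB := hsc.le_two_mul_card hG hU hAB (.inr hB)
  have hd := Finset.disjoint_left.1 hAB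
  obtain ⟨v, hv⟩ := hB
  have hpos := Finset.card_pos.2 ⟨v, hv⟩
  have herase := Finset.card_erase_of_mem hv
  obtain ⟨k, hk₁, hk₂, h₁, h₂⟩ : ∃ k, 1 ≤ k ∧ k ≤ 2 ∧ k + (B.erase v).card ≤ max s B.card ∧
      max s B.card ≤ k + 2 * (B.erase v).card := by
    by_cases h : max s B.card = 2 * B.card
    · exact ⟨2, by omega⟩
    · exact ⟨1, by omega⟩
  have h := (hcov (max s B.card) (by omega) (by omega)).join_finset (B.erase v)
    (hAB.mono_right (Finset.erase_subset _ _))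
    (fun u hu w hw => hadj u hu w (Finset.mem_of_mem_erase hw)) hk₁ h₁ h₂
  refine h.hasHamCycle_prism hcard hk₁ hk₂ ?_ ?_ fun u hu => hadj u hu v hv
  · rw [← hU, ← Finset.union_insert, Finset.insert_erase hv]
  · simpa using fun h => hd h hv

lemma hasHamCycle_prism_of_tough [Fintype V] [DecidableEq V] {G : SimpleGraph V}
    (hcard : 2 ≤ Fintype.card V) (hP : NoInducedP4 G) (hG : Tough (1 / 2 : ℝ) G) :
    HasHamCycle (prism G) := by
  obtain ⟨B, C, hB, hC, hBC, hU, hN⟩ | ⟨B, C, hB, hC, hBC, hU, hN⟩ :=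
    hP.splits_or_splits_compl Finset.univ hcard
  · exfalso
    rw [← Finset.coe_union, Finset.coe_inj] at hU
    have hs := (isScattered_one G hB).union (isScattered_one G hC) hBC hN
    have := hs.le_two_mul_card hG (B := ∅) (by simpa using hU) (by simp) (.inl le_rfl)
    simp at this
  · rw [← Finset.coe_union, Finset.coe_inj] at hU
    have hadj : ∀ x ∈ B, ∀ y ∈ C, G.Adj x y := fun x hx y hy => by
      by_contra h
      exact hN x hx y hy ⟨fun h => Finset.disjoint_left.1 hBC hx (h ▸ hy), h⟩
    obtain hle | hle := le_total C.card B.card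
    · exact hasHamCycle_prism_of_join hcard hP hG hB hC hBC hU hadj hle
    · exact hasHamCycle_prism_of_join hcard hP hG hC hB hBC.symm (Finset.union_comm B C ▸ hU)
        (fun x hx y hy => (hadj y hy x hx).symm) hle

/-- For a `P₄`-free graph with at least two vertices, being
prism-hamiltonian, having a spanning 2-walk, and being `1/2`-tough are equivalent. -/
theorem stmt_3 {V : Type*} [Fintype V] [DecidableEq V] (G : SimpleGraph V)
    (hcard : 2 ≤ Fintype.card V) (hP4 : P4Free G) :
    (HasHamCycle (prism G) ↔ HasSpanningKWalk G 2) ∧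
    (HasSpanningKWalk G 2 ↔ Tough (1 / 2 : ℝ) G) := by
  have h := hasHamCycle_prism_of_tough (G := G) hcard hP4.noInducedP4
  exact ⟨⟨hasSpanningKWalk_of_hasHamCycle_prism, fun hw => h (tough_half_of_hasSpanningKWalk hw)⟩,
    tough_half_of_hasSpanningKWalk, fun ht => hasSpanningKWalk_of_hasHamCycle_prism (h ht)⟩
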